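/- Let S be a commutative semiring and B an S-bisemialgebra with multiplication μ, unit 1_B, comultiplication Δ (Sweedler notation Δ(b) = Σ b_1 ⊗ b_2) and counit ε. The following are equivalent: (1) B has an antipode, i.e., an S-linear map 𝔞 : B → B with Σ 𝔞(b_1)·b_2 = ε(b)·1_B = Σ b_1·𝔞(b_2) for all b ∈ B; (2) the Galois map γ_B : B ⊗_S B → B ⊗_S B, a ⊗ b ↦ Σ a·b_1 ⊗ b_2, has an S-linear two-sided inverse ω : B ⊗_S B → B ⊗_S B (ω∘γ_B = id and γ_B∘ω = id) which is left B-linear for the action c·(x ⊗ y) = c·x ⊗ y and right B-colinear in the sense that (ω ⊗ id_B) ∘ (id_B ⊗ Δ) = (id_B ⊗ Δ) ∘ ω. Moreover, when an antipode 𝔞 exists, the inverse is given by ω(a ⊗ b) = Σ a·𝔞(b_1) ⊗ b_2. -/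

import Mathlib

/-!
STATEMENT 8: Let `S` be a commutative semiring and `B` an `S`-bisemialgebra.
The following are equivalent:
(1) `B` has an antipode `𝔞` (`Σ 𝔞(b₁)·b₂ = ε b • 1 = Σ b₁·𝔞(b₂)`);
(2) the Galois map `γ_B : B ⊗[S] B → B ⊗[S] B`, `a ⊗ b ↦ Σ a·b₁ ⊗ b₂`, has an
`S`-linear two-sided inverse `ω` which is left `B`-linear (for the action
`c·(x ⊗ y) = c·x ⊗ y`) and right `B`-colinear
(`(ω ⊗ id) ∘ (id ⊗ Δ) = (id ⊗ Δ) ∘ ω`, for the coaction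
`x ⊗ y ↦ (x ⊗ y₁) ⊗ y₂`).
Moreover, when an antipode `𝔞` exists, the inverse is
`ω (a ⊗ b) = Σ a·𝔞(b₁) ⊗ b₂`.
-/

open TensorProduct

variable (S : Type*) [CommSemiring S] (B : Type*) [Semiring B] [Bialgebra S B]

/-- The coaction of `B` on `B ⊗ᶜ B`: `x ⊗ y ↦ (x ⊗ y₁) ⊗ y₂`. -/
noncomputable def rcoaction : B ⊗[S] B →ₗ[S] (B ⊗[S] B) ⊗[S] B :=
  (TensorProduct.assoc S B B B).symm.toLinearMap ∘ₗ
    LinearMap.lTensor B (Coalgebra.comul (R := S))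

/-- The Galois map `γ_B : B ⊗[S] B → B ⊗[S] B`, `a ⊗ b ↦ Σ a·b₁ ⊗ b₂`. -/
noncomputable def galoisMap : B ⊗[S] B →ₗ[S] B ⊗[S] B :=
  TensorProduct.map (LinearMap.mul' S B) LinearMap.id ∘ₗ rcoaction S B

/-- `𝔞 : B → B` is an antipode: `Σ 𝔞(b₁)·b₂ = ε b • 1 = Σ b₁·𝔞(b₂)`. -/
def IsAntipode (a : B →ₗ[S] B) : Prop :=
  (∀ b : B, LinearMap.mul' S B (LinearMap.rTensor B a (Coalgebra.comul b)) =
    algebraMap S B (Coalgebra.counit (R := S) b)) ∧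
  (∀ b : B, LinearMap.mul' S B (LinearMap.lTensor B a (Coalgebra.comul b)) =
    algebraMap S B (Coalgebra.counit (R := S) b))

/-- `ω` is a two-sided inverse of the Galois map which is left `B`-linear and
right `B`-colinear. -/
noncomputable def IsGaloisInverse (ω : B ⊗[S] B →ₗ[S] B ⊗[S] B) : Prop :=
  ω ∘ₗ galoisMap S B = LinearMap.id ∧
  galoisMap S B ∘ₗ ω = LinearMap.id ∧
  (∀ c : B, ω ∘ₗ LinearMap.rTensor B (LinearMap.mulLeft S c) =
    LinearMap.rTensor B (LinearMap.mulLeft S c) ∘ₗ ω) ∧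
  LinearMap.rTensor B ω ∘ₗ rcoaction S B = rcoaction S B ∘ₗ ω

/-- The map `a ⊗ b ↦ Σ a·𝔞(b₁) ⊗ b₂` built from a candidate antipode `𝔞`. -/
noncomputable def omegaOf (a : B →ₗ[S] B) : B ⊗[S] B →ₗ[S] B ⊗[S] B :=
  TensorProduct.map (LinearMap.mul' S B) LinearMap.id ∘ₗ
    (TensorProduct.assoc S B B B).symm.toLinearMap ∘ₗ
      LinearMap.lTensor B (LinearMap.rTensor B a ∘ₗ Coalgebra.comul (R := S))

namespace GaloisMap

variable {S B}

/-- The convolution product `b ↦ Σ f(b₁)·g(b₂)`. -/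
noncomputable def conv (f g : B →ₗ[S] B) : B →ₗ[S] B :=
  LinearMap.mul' S B ∘ₗ TensorProduct.map f g ∘ₗ Coalgebra.comul

/-- The unit `b ↦ ε(b)·1` of the convolution product. -/
noncomputable def convUnit : B →ₗ[S] B :=
  Algebra.linearMap S B ∘ₗ Coalgebra.counit

lemma isAntipode_iff (f : B →ₗ[S] B) :
    IsAntipode S B f ↔ conv f .id = convUnit ∧ conv .id f = convUnit := by
  simp only [IsAntipode, LinearMap.ext_iff]
  rfl

lemma galoisMap_eq_omegaOf_id : galoisMap S B = omegaOf S B .id := by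
  rw [galoisMap, rcoaction, omegaOf, LinearMap.rTensor_id, LinearMap.id_comp]

lemma omegaOf_tmul (f : B →ₗ[S] B) (a b : B) :
    omegaOf S B f (a ⊗ₜ b) =
      (LinearMap.mulLeft S a ∘ₗ f).rTensor B (Coalgebra.comul b) := by
  have key (t : B ⊗[S] B) : TensorProduct.map (LinearMap.mul' S B) LinearMap.id
      ((TensorProduct.assoc S B B B).symm (a ⊗ₜ f.rTensor B t)) =
        (LinearMap.mulLeft S a ∘ₗ f).rTensor B t := by
    induction t with
    | zero => simp
    | tmul x y => simp
    | add x y hx hy => simp only [map_add, TensorProduct.tmul_add, hx, hy]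
  exact key _

lemma rcoaction_tmul (a b : B) :
    rcoaction S B (a ⊗ₜ b) = (TensorProduct.assoc S B B B).symm (a ⊗ₜ Coalgebra.comul b) :=
  rfl

lemma rcoaction_comul (b : B) :
    rcoaction S B (Coalgebra.comul b) =
      (Coalgebra.comul (R := S)).rTensor B (Coalgebra.comul b) :=
  Coalgebra.coassoc_symm_apply b

lemma rcoaction_rTensor (g : B →ₗ[S] B) (t : B ⊗[S] B) :
    rcoaction S B (g.rTensor B t) = (g.rTensor B).rTensor B (rcoaction S B t) := by
  induction t with
  | zero => simp
  | add x y hx hy => simp only [map_add, hx, hy]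
  | tmul x y =>
    simp only [LinearMap.rTensor_tmul, rcoaction_tmul]
    generalize (Coalgebra.comul y : B ⊗[S] B) = u
    induction u with
    | zero => simp
    | add u v hu hv => simp only [map_add, TensorProduct.tmul_add, hu, hv]
    | tmul u v => simp

lemma omegaOf_eq (f : B →ₗ[S] B) (t : B ⊗[S] B) :
    omegaOf S B f t =
      (LinearMap.mul' S B ∘ₗ f.lTensor B).rTensor B (rcoaction S B t) := by
  induction t with
  | zero => simp
  | add x y hx hy => simp only [map_add, hx, hy]
  | tmul x y =>
    rw [omegaOf_tmul, rcoaction_tmul]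
    generalize (Coalgebra.comul y : B ⊗[S] B) = u
    induction u with
    | zero => simp
    | add u v hu hv => simp only [map_add, TensorProduct.tmul_add, hu, hv]
    | tmul u v => simp

lemma omegaOf_comp (f g : B →ₗ[S] B) :
    omegaOf S B f ∘ₗ omegaOf S B g = omegaOf S B (conv g f) := by
  refine TensorProduct.ext' fun a b ↦ ?_
  rw [LinearMap.comp_apply, omegaOf_tmul, omegaOf_tmul, omegaOf_eq, rcoaction_rTensor,
    rcoaction_comul]
  have key : (LinearMap.mul' S B ∘ₗ f.lTensor B) ∘ₗ (LinearMap.mulLeft S a ∘ₗ g).rTensor B =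
      LinearMap.mulLeft S a ∘ₗ LinearMap.mul' S B ∘ₗ TensorProduct.map g f :=
    TensorProduct.ext' fun x y ↦ by simp [mul_assoc]
  rw [← LinearMap.rTensor_comp_apply, ← LinearMap.rTensor_comp_apply, key]
  rfl

lemma omegaOf_convUnit : omegaOf S B convUnit = LinearMap.id := by
  refine TensorProduct.ext' fun a b ↦ ?_
  rw [omegaOf_tmul, convUnit, ← LinearMap.comp_assoc, LinearMap.rTensor_comp_apply,
    Coalgebra.rTensor_counit_comul]
  simp

lemma omegaOf_comp_mulLeft (f : B →ₗ[S] B) (c : B) :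
    omegaOf S B f ∘ₗ (LinearMap.mulLeft S c).rTensor B =
      (LinearMap.mulLeft S c).rTensor B ∘ₗ omegaOf S B f := by
  refine TensorProduct.ext' fun a b ↦ ?_
  simp only [LinearMap.comp_apply, LinearMap.rTensor_tmul, LinearMap.mulLeft_apply, omegaOf_tmul,
    ← LinearMap.rTensor_comp_apply, ← LinearMap.comp_assoc, ← LinearMap.mulLeft_mul]

lemma rTensor_omegaOf_comp_rcoaction (f : B →ₗ[S] B) :
    (omegaOf S B f).rTensor B ∘ₗ rcoaction S B = rcoaction S B ∘ₗ omegaOf S B f := by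
  refine TensorProduct.ext' fun a b ↦ ?_
  rw [LinearMap.comp_apply, LinearMap.comp_apply, omegaOf_tmul, rcoaction_rTensor,
    rcoaction_comul, rcoaction_tmul, ← LinearMap.rTensor_comp_apply]
  generalize (Coalgebra.comul b : B ⊗[S] B) = u
  induction u with
  | zero => simp
  | add u v hu hv => simp only [map_add, TensorProduct.tmul_add, hu, hv]
  | tmul u v => simp [omegaOf_tmul]

/-- The map `a ⊗ b ↦ ε(b)·a`. -/
noncomputable def counitRight : B ⊗[S] B →ₗ[S] B :=
  (TensorProduct.rid S B).toLinearMap ∘ₗ (Coalgebra.counit (R := S)).lTensor B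

lemma counitRight_rTensor (g : B →ₗ[S] B) (t : B ⊗[S] B) :
    counitRight (g.rTensor B t) = g (counitRight t) := by
  induction t with
  | zero => simp
  | add x y hx hy => simp only [map_add, hx, hy]
  | tmul x y => simp [counitRight]

lemma counitRight_comul (b : B) : counitRight (S := S) (Coalgebra.comul b) = b := by
  simp [counitRight]

lemma rTensor_counitRight_rcoaction (t : B ⊗[S] B) :
    (counitRight (S := S)).rTensor B (rcoaction S B t) = t := by
  induction t with
  | zero => simp
  | add x y hx hy => simp only [map_add, hx, hy]
  | tmul x y =>
    have key (u : B ⊗[S] B) : (counitRight (S := S)).rTensor B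
        ((TensorProduct.assoc S B B B).symm (x ⊗ₜ u)) =
          x ⊗ₜ TensorProduct.lid S B ((Coalgebra.counit (R := S)).rTensor B u) := by
      induction u with
      | zero => simp
      | add u v hu hv => simp only [map_add, TensorProduct.tmul_add, hu, hv]
      | tmul u v => simp [counitRight, TensorProduct.smul_tmul]
    rw [rcoaction_tmul, key, Coalgebra.rTensor_counit_comul, TensorProduct.lid_tmul, one_smul]

lemma omegaOf_injective : Function.Injective (omegaOf S B) := by
  have key (f : B →ₗ[S] B) (b : B) : counitRight (omegaOf S B f (1 ⊗ₜ b)) = f b := by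
    rw [omegaOf_tmul, counitRight_rTensor, counitRight_comul]
    simp
  intro f g h
  ext b
  rw [← key f, h, key]

lemma exists_eq_omegaOf {ω : B ⊗[S] B →ₗ[S] B ⊗[S] B}
    (hl : ∀ c : B, ω ∘ₗ (LinearMap.mulLeft S c).rTensor B =
      (LinearMap.mulLeft S c).rTensor B ∘ₗ ω)
    (hc : ω.rTensor B ∘ₗ rcoaction S B = rcoaction S B ∘ₗ ω) :
    ∃ f : B →ₗ[S] B, ω = omegaOf S B f := by
  refine ⟨counitRight ∘ₗ ω ∘ₗ TensorProduct.mk S B B 1, TensorProduct.ext' fun a b ↦ ?_⟩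
  have hl' (c : B) (t : B ⊗[S] B) : ω ((LinearMap.mulLeft S c).rTensor B t) =
      (LinearMap.mulLeft S c).rTensor B (ω t) := LinearMap.congr_fun (hl c) t
  rw [← rTensor_counitRight_rcoaction (ω (a ⊗ₜ b)), omegaOf_tmul,
    ← LinearMap.comp_apply (rcoaction S B), ← hc, LinearMap.comp_apply, rcoaction_tmul]
  generalize (Coalgebra.comul b : B ⊗[S] B) = u
  induction u with
  | zero => simp
  | add u v hu hv => simp only [map_add, TensorProduct.tmul_add, hu, hv]
  | tmul u v =>
    have h : ω (a ⊗ₜ u) = (LinearMap.mulLeft S a).rTensor B (ω (1 ⊗ₜ u)) := by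
      rw [← hl']
      simp
    simp [h, counitRight_rTensor]

lemma isGaloisInverse_omegaOf_iff (f : B →ₗ[S] B) :
    IsGaloisInverse S B (omegaOf S B f) ↔ IsAntipode S B f := by
  rw [isAntipode_iff, IsGaloisInverse, galoisMap_eq_omegaOf_id, omegaOf_comp, omegaOf_comp,
    ← omegaOf_convUnit, omegaOf_injective.eq_iff, omegaOf_injective.eq_iff]
  exact ⟨fun h ↦ ⟨h.2.1, h.1⟩, fun h ↦
    ⟨h.2, h.1, omegaOf_comp_mulLeft f, rTensor_omegaOf_comp_rcoaction f⟩⟩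

end GaloisMap

theorem antipode_iff_galoisMap_invertible :
    ((∃ a : B →ₗ[S] B, IsAntipode S B a) ↔
      (∃ ω : B ⊗[S] B →ₗ[S] B ⊗[S] B, IsGaloisInverse S B ω)) ∧
    (∀ a : B →ₗ[S] B, IsAntipode S B a → IsGaloisInverse S B (omegaOf S B a)) := by
  refine ⟨⟨fun ⟨a, ha⟩ ↦ ⟨_, (GaloisMap.isGaloisInverse_omegaOf_iff a).2 ha⟩, ?_⟩,
    fun a ↦ (GaloisMap.isGaloisInverse_omegaOf_iff a).2⟩
  rintro ⟨ω, hω⟩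
  obtain ⟨a, rfl⟩ := GaloisMap.exists_eq_omegaOf hω.2.2.1 hω.2.2.2
  exact ⟨a, (GaloisMap.isGaloisInverse_omegaOf_iff a).1 hω⟩
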